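/- Let U be an N×N unitary matrix with orthonormal eigenbasis {χ_j}_{j=0}^{N−1} and eigenphases τ_j ∈ ℝ (so Uχ_j = e^{iτ_j}χ_j), and let ρ be an N×N density matrix. Let F(x) = Σ_{j=−L}^{L} c_j e^{ijx} be a trigonometric polynomial that is real-valued on ℝ with |F(x)| ≤ 1 for all x ∈ ℝ. Then there exist ω ∈ ℝ and θ, φ ∈ ℝ^{L+1} such that tr[(Z ⊗ I_N) · V^L_{ω,θ,φ}(U) (e_0 e_0† ⊗ ρ) V^L_{ω,θ,φ}(U)†] = Σ_{j=0}^{N−1} ⟨χ_j, ρ χ_j⟩ · F(τ_j). -/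

import Mathlib

open scoped Matrix

/-- `R_z(φ) = diag(e^{-iφ/2}, e^{iφ/2})`. -/
noncomputable def Rz (φ : ℝ) : Matrix (Fin 2) (Fin 2) ℂ :=
  !![Complex.exp (-(Complex.I * φ / 2)), 0; 0, Complex.exp (Complex.I * φ / 2)]

/-- `R_y(θ)`, the real rotation by angle `θ/2`, viewed as a complex matrix. -/
noncomputable def Ry (θ : ℝ) : Matrix (Fin 2) (Fin 2) ℂ :=
  !![(Real.cos (θ / 2) : ℂ), -(Real.sin (θ / 2) : ℂ);
     (Real.sin (θ / 2) : ℂ), (Real.cos (θ / 2) : ℂ)]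

/-- The trigonometric QSP unitary
`W^L_{ω,θ,φ}(x) = R_z(ω) R_y(θ_0) R_z(φ_0) ∏_{l=1}^{L} [R_z(x) R_y(θ_l) R_z(φ_l)]`,
multiplied left to right in increasing `l`. -/
noncomputable def Wqsp (L : ℕ) (ω : ℝ) (θ φ : ℕ → ℝ) (x : ℝ) :
    Matrix (Fin 2) (Fin 2) ℂ :=
  Rz ω * Ry (θ 0) * Rz (φ 0) *
    ((List.range L).map (fun l => Rz x * Ry (θ (l + 1)) * Rz (φ (l + 1)))).prod

open scoped Kronecker ComplexOrder

/-- Block-diagonal matrix `B(X,Y)` with upper-left block `X` and lower-right block `Y`,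
as a matrix on `ℂ² ⊗ ℂⁿ`. -/
noncomputable def blockDiag2 {n : Type*} [Fintype n] [DecidableEq n]
    (X Y : Matrix n n ℂ) : Matrix (Fin 2 × n) (Fin 2 × n) ℂ :=
  (!![1, 0; 0, 0] : Matrix (Fin 2) (Fin 2) ℂ) ⊗ₖ X +
    (!![0, 0; 0, 1] : Matrix (Fin 2) (Fin 2) ℂ) ⊗ₖ Y

/-- The QPP circuit for an even number `2·halfL` of layers. -/
noncomputable def qppEven {n : Type*} [Fintype n] [DecidableEq n]
    (U : Matrix n n ℂ) (halfL : ℕ) (ω : ℝ) (θ φ : ℕ → ℝ) :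
    Matrix (Fin 2 × n) (Fin 2 × n) ℂ :=
  ((Rz ω * Ry (θ 0) * Rz (φ 0)) ⊗ₖ (1 : Matrix n n ℂ)) *
    ((List.range halfL).map (fun l =>
      blockDiag2 Uᴴ 1 *
        ((Ry (θ (2 * l + 1)) * Rz (φ (2 * l + 1))) ⊗ₖ (1 : Matrix n n ℂ)) *
        blockDiag2 1 U *
        ((Ry (θ (2 * l + 2)) * Rz (φ (2 * l + 2))) ⊗ₖ (1 : Matrix n n ℂ)))).prod

/-- The quantum phase processing (QPP) circuit `V^L_{ω,θ,φ}(U)`: for even `L` it is the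
interleaved product of ancilla rotations and controlled-`U†`, controlled-`U`; for odd `L`
one extra layer `B(U†, I)·(R_y(θ_L) R_z(φ_L) ⊗ I)` is appended. -/
noncomputable def qpp {n : Type*} [Fintype n] [DecidableEq n]
    (U : Matrix n n ℂ) (L : ℕ) (ω : ℝ) (θ φ : ℕ → ℝ) :
    Matrix (Fin 2 × n) (Fin 2 × n) ℂ :=
  if L % 2 = 0 then qppEven U (L / 2) ω θ φ
  else qppEven U (L / 2) ω θ φ * blockDiag2 Uᴴ 1 *
    ((Ry (θ L) * Rz (φ L)) ⊗ₖ (1 : Matrix n n ℂ))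

open Polynomial ComplexConjugate Topology

theorem eval_reflect_map_conj {p : ℂ[X]} {n : ℕ} (hp : p.natDegree ≤ n) {z : ℂ} (hz : z ≠ 0) :
    (reflect n (p.map (starRingEnd ℂ))).eval z = z ^ n * conj (p.eval (conj z)⁻¹) := by
  let : Invertible z⁻¹ := invertibleOfNonzero (inv_ne_zero hz)
  have h := eval₂_reflect_mul_pow (RingHom.id ℂ) z⁻¹ n (p.map (starRingEnd ℂ))
    ((natDegree_map_le).trans hp)
  rw [invOf_eq_inv, inv_inv, eval₂_id, eval₂_id] at h
  have h2 : conj (p.eval (conj z)⁻¹) = (p.map (starRingEnd ℂ)).eval z⁻¹ := by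
    rw [eval_map, ← eval₂_at_apply, map_inv₀, Complex.conj_conj]
  rw [h2, ← h]
  rw [mul_comm (z ^ n), mul_assoc, ← mul_pow, inv_mul_cancel₀ hz, one_pow, mul_one]

theorem infinite_unit_circle : {z : ℂ | ‖z‖ = 1}.Infinite := by
  have h := (isPreconnected_sphere (E := ℂ) (by simp) 0 1).infinite_of_nontrivial
    ⟨1, by simp, -1, by simp, by norm_num⟩
  convert h using 1
  ext z
  simp

theorem eq_of_eval_eq_on_unit_circle {p q : ℂ[X]}
    (h : ∀ z : ℂ, ‖z‖ = 1 → p.eval z = q.eval z) : p = q :=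
  eq_of_infinite_eval_eq p q (infinite_unit_circle.mono h)

theorem inv_conj_of_norm_eq_one {z : ℂ} (hz : ‖z‖ = 1) : (conj z)⁻¹ = z := by
  rw [← map_inv₀, Complex.inv_eq_conj hz, Complex.conj_conj]

theorem conj_mul_self_of_norm_eq_one {z : ℂ} (hz : ‖z‖ = 1) : conj z * z = 1 := by
  rw [Complex.conj_mul', hz]; norm_num

/-- A polynomial `g` for which `z⁻ᴸ g(z)` is real on the unit circle is self-reciprocal. -/
theorem reflect_map_conj_eq_self {g : ℂ[X]} {L : ℕ} (hg : g.natDegree ≤ 2 * L)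
    (h : ∀ z : ℂ, ‖z‖ = 1 → 0 ≤ g.eval z * conj z ^ L) :
    reflect (2 * L) (g.map (starRingEnd ℂ)) = g := by
  refine eq_of_eval_eq_on_unit_circle fun z hz => ?_
  have hzz := conj_mul_self_of_norm_eq_one hz
  have hz0 : z ≠ 0 := by rintro rfl; simp at hz
  have hinv : (conj z)⁻¹ = z := inv_conj_of_norm_eq_one hz
  rw [eval_reflect_map_conj hg hz0, hinv]
  have hr : conj (g.eval z * conj z ^ L) = g.eval z * conj z ^ L :=
    Complex.conj_eq_iff_im.2 (Complex.nonneg_iff.1 (h z hz)).2.symm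
  rw [map_mul, map_pow, Complex.conj_conj] at hr
  calc z ^ (2 * L) * conj (g.eval z) = z ^ L * (conj (g.eval z) * z ^ L) := by ring
    _ = g.eval z * (conj z * z) ^ L := by rw [hr]; ring
    _ = g.eval z := by rw [hzz]; simp

/-- The derivative of a circle-nonnegative polynomial vanishes at its zeros on the circle. -/
theorem eval_derivative_eq_zero_of_nonneg_on_circle {g : ℂ[X]} {L : ℕ}
    (h : ∀ z : ℂ, ‖z‖ = 1 → 0 ≤ g.eval z * conj z ^ L) {a : ℂ} (ha : ‖a‖ = 1)
    (hga : g.eval a = 0) : g.derivative.eval a = 0 := by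
  obtain ⟨t, rfl⟩ : ∃ t : ℝ, Complex.exp (t * Complex.I) = a := by
    refine ⟨a.arg, ?_⟩
    simpa [ha] using Complex.norm_mul_exp_arg_mul_I a
  set e : ℝ → ℂ := fun x => Complex.exp (x * Complex.I) with he
  have hnorm (x : ℝ) : ‖e x‖ = 1 := Complex.norm_exp_ofReal_mul_I x
  have hde : HasDerivAt e (e t * Complex.I) t := by
    simpa using ((Complex.ofRealCLM.hasDerivAt (x := t)).mul_const Complex.I).cexp
  have hdc : HasDerivAt (fun x => conj (e x)) (conj (e t * Complex.I)) t :=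
    Complex.conjCLE.toContinuousLinearMap.hasFDerivAt.comp_hasDerivAt t hde
  have hd := ((g.hasDerivAt (e t)).comp t hde).mul (hdc.pow L)
  have hzero : g.eval (e t) = 0 := hga
  simp only [Function.comp_apply, hzero, zero_mul, add_zero] at hd
  set D := g.derivative.eval (e t) * (e t * Complex.I) * conj (e t) ^ L with hD
  have hre : HasDerivAt (fun x => (g.eval (e x) * conj (e x) ^ L).re) D.re t :=
    Complex.reCLM.hasFDerivAt.comp_hasDerivAt t hd
  have him : HasDerivAt (fun x => (g.eval (e x) * conj (e x) ^ L).im) D.im t :=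
    Complex.imCLM.hasFDerivAt.comp_hasDerivAt t hd
  have hD0 : D = 0 := by
    apply Complex.ext
    · refine IsLocalMin.hasDerivAt_eq_zero (.of_forall fun x => ?_) hre
      simpa [hzero] using (Complex.nonneg_iff.1 (h _ (hnorm x))).1
    · have : (fun x => (g.eval (e x) * conj (e x) ^ L).im) = fun _ => 0 :=
        funext fun x => (Complex.nonneg_iff.1 (h _ (hnorm x))).2.symm
      rw [this] at him
      exact him.unique (hasDerivAt_const t 0)
  have he0 : e t ≠ 0 := Complex.exp_ne_zero _
  simpa [hD, he0, Complex.I_ne_zero] using hD0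

/-- Nonnegativity on the circle extends across a single point by continuity. -/
theorem nonneg_on_circle_of_ne {k : ℂ → ℂ} (hk : Continuous k) {a : ℂ}
    (h : ∀ z : ℂ, ‖z‖ = 1 → z ≠ a → 0 ≤ k z) {z : ℂ} (hz : ‖z‖ = 1) : 0 ≤ k z := by
  obtain ⟨t, rfl⟩ : ∃ t : ℝ, Complex.exp (t * Complex.I) = z := by
    refine ⟨z.arg, ?_⟩
    simpa [hz] using Complex.norm_mul_exp_arg_mul_I z
  have hde : HasDerivAt (fun x : ℝ => Complex.exp (x * Complex.I))
      (Complex.exp (t * Complex.I) * Complex.I) t := by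
    simpa using ((Complex.ofRealCLM.hasDerivAt (x := t)).mul_const Complex.I).cexp
  have hne := hde.eventually_ne (c := a) (mul_ne_zero (Complex.exp_ne_zero _) Complex.I_ne_zero)
  have hlim : Filter.Tendsto (fun x : ℝ => k (Complex.exp (x * Complex.I))) (𝓝[≠] t)
      (𝓝 (k (Complex.exp (t * Complex.I)))) :=
    Continuous.continuousWithinAt (by fun_prop)
  exact ge_of_tendsto hlim (hne.mono fun x hx => h _ (Complex.norm_exp_ofReal_mul_I x) hx)

theorem reciprocal_roots_dvd {g : ℂ[X]} {L : ℕ} (hg : g.natDegree ≤ 2 * L)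
    (h : ∀ z : ℂ, ‖z‖ = 1 → 0 ≤ g.eval z * conj z ^ L) {a : ℂ} (ha0 : a ≠ 0)
    (ha : g.eval a = 0) : (X - C a) * (X - C (conj a)⁻¹) ∣ g := by
  have hdvd : X - C a ∣ g := dvd_iff_isRoot.2 ha
  by_cases hn : ‖a‖ = 1
  · have hinv : (conj a)⁻¹ = a :=
      inv_conj_of_norm_eq_one hn
    obtain ⟨k, rfl⟩ := hdvd
    rw [hinv]
    refine mul_dvd_mul_left _ (dvd_iff_isRoot.2 ?_)
    simpa using eval_derivative_eq_zero_of_nonneg_on_circle h hn ha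
  · have hb : g.eval (conj a)⁻¹ = 0 := by
      rw [← reflect_map_conj_eq_self hg h, eval_reflect_map_conj hg (by simpa using ha0)]
      simp [ha]
    refine IsCoprime.mul_dvd (isCoprime_X_sub_C_of_isUnit_sub ?_) hdvd (dvd_iff_isRoot.2 hb)
    rw [isUnit_iff_ne_zero, sub_ne_zero]
    intro hab
    apply hn
    have h1 : conj a * a = 1 := by
      nth_rewrite 2 [hab]
      exact mul_inv_cancel₀ (by simpa using ha0)
    rw [Complex.conj_mul'] at h1
    have h2 : ‖a‖ ^ 2 = 1 := by exact_mod_cast h1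
    nlinarith [norm_nonneg a]

/-- **Fejér–Riesz**: a nonnegative trigonometric polynomial `z⁻ᴸ g(z)` of degree at most `L`
is the squared modulus of a polynomial of degree at most `L` on the unit circle. -/
theorem fejer_riesz (L : ℕ) : ∀ g : ℂ[X], g.natDegree ≤ 2 * L →
    (∀ z : ℂ, ‖z‖ = 1 → 0 ≤ g.eval z * conj z ^ L) →
    ∃ p : ℂ[X], p.natDegree ≤ L ∧
      ∀ z : ℂ, ‖z‖ = 1 → g.eval z * conj z ^ L = p.eval z * conj (p.eval z) := by
  induction L with
  | zero =>
    intro g hg h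
    obtain ⟨c, rfl⟩ := natDegree_eq_zero.1 (by simpa using hg)
    have hc : 0 ≤ c := by simpa using h 1 (by simp)
    refine ⟨C ((Real.sqrt c.re : ℝ) : ℂ), by simp, fun z _ => ?_⟩
    rw [Complex.nonneg_iff] at hc
    simp only [eval_C, pow_zero, mul_one, Complex.conj_ofReal, ← Complex.ofReal_mul,
      Real.mul_self_sqrt hc.1]
    exact Complex.ext (by simp) (by simp [← hc.2])
  | succ L ih =>
    intro g hg h
    by_cases h0 : g.coeff 0 = 0
    · have htop : g.coeff (2 * (L + 1)) = 0 := by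
        rw [← reflect_map_conj_eq_self hg h, coeff_reflect, revAt_le le_rfl]
        simp [h0]
      obtain ⟨k, rfl⟩ := X_dvd_iff.2 h0
      have hk : k.natDegree ≤ 2 * L := by
        rw [natDegree_le_iff_coeff_eq_zero]
        intro n hn
        rw [← coeff_X_mul]
        rcases eq_or_lt_of_le (Nat.succ_le_of_lt hn) with h1 | h1
        · rw [← h1]; exact htop
        · exact coeff_eq_zero_of_natDegree_lt (by omega)
      have hkeq (z : ℂ) (hz : ‖z‖ = 1) :
          (X * k).eval z * conj z ^ (L + 1) = k.eval z * conj z ^ L := by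
        calc _ = k.eval z * conj z ^ L * (conj z * z) := by simp; ring
          _ = _ := by rw [conj_mul_self_of_norm_eq_one hz, mul_one]
      obtain ⟨p, hp, hpe⟩ := ih k hk fun z hz => hkeq z hz ▸ h z hz
      exact ⟨p, by omega, fun z hz => by rw [hkeq z hz, hpe z hz]⟩
    · have hcoeff : g.coeff (2 * (L + 1)) ≠ 0 := by
        rw [← reflect_map_conj_eq_self hg h, coeff_reflect, revAt_le le_rfl]
        simpa using h0
      have hdeg : 0 < g.degree :=
        natDegree_pos_iff_degree_pos.1 (by have := le_natDegree_of_ne_zero hcoeff; omega)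
      obtain ⟨a, ha⟩ := Complex.exists_root hdeg
      have ha0 : a ≠ 0 := by
        rintro rfl
        exact h0 (by rw [coeff_zero_eq_eval_zero]; exact ha)
      obtain ⟨k, hk⟩ := reciprocal_roots_dvd hg h ha0 ha
      set b := (conj a)⁻¹ with hb
      have hk0 : k ≠ 0 := by rintro rfl; simp [hk] at h0
      have hkd : (C (-b) * k).natDegree ≤ 2 * L := by
        refine (natDegree_C_mul_le _ _).trans ?_
        rw [hk, natDegree_mul (mul_ne_zero (X_sub_C_ne_zero a) (X_sub_C_ne_zero b)) hk0,
          natDegree_mul (X_sub_C_ne_zero a) (X_sub_C_ne_zero b), natDegree_X_sub_C,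
          natDegree_X_sub_C] at hg
        omega
      have hkeq (z : ℂ) (hz : ‖z‖ = 1) : g.eval z * conj z ^ (L + 1) =
          ((C (-b) * k).eval z * conj z ^ L) * ((z - a) * conj (z - a)) := by
        have hzz := conj_mul_self_of_norm_eq_one hz
        have hab : conj a * b = 1 := mul_inv_cancel₀ (by simpa using ha0)
        simp only [hk, eval_mul, eval_sub, eval_X, eval_C, map_sub]
        linear_combination (eval z k * conj z ^ L * (z - a)) * (hzz - hab)
      have hnonneg (z : ℂ) (hz : ‖z‖ = 1) : 0 ≤ (C (-b) * k).eval z * conj z ^ L := by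
        refine nonneg_on_circle_of_ne (k := fun z => (C (-b) * k).eval z * conj z ^ L)
          (a := a) (by fun_prop) (fun w hw hwa => ?_) hz
        have hpos : 0 < Complex.normSq (w - a) := Complex.normSq_pos.2 (sub_ne_zero.2 hwa)
        have hw' := h w hw
        rw [hkeq w hw, Complex.mul_conj] at hw'
        have hinv : (0 : ℂ) ≤ ((Complex.normSq (w - a))⁻¹ : ℝ) := by
          exact_mod_cast (inv_pos.2 hpos).le
        have hmul := mul_nonneg hw' hinv
        rwa [mul_assoc, ← Complex.ofReal_mul, mul_inv_cancel₀ hpos.ne', Complex.ofReal_one,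
          mul_one] at hmul
      obtain ⟨p, hp, hpe⟩ := ih _ hkd hnonneg
      refine ⟨p * (X - C a), (natDegree_mul_le.trans (by rw [natDegree_X_sub_C]; omega)),
        fun z hz => ?_⟩
      rw [hkeq z hz, hpe z hz]
      simp only [eval_mul, eval_sub, eval_X, eval_C, map_mul]
      ring

theorem Rz_mul_Rz (a b : ℝ) : Rz a * Rz b = Rz (a + b) := by
  simp only [Rz, Matrix.mul_fin_two, mul_zero, zero_mul, add_zero, zero_add, ← Complex.exp_add]
  push_cast
  congr 3 <;> ring_nf

/-- Euler-angle parametrisation of `SU(2)`. -/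
theorem exists_euler_angles {α β : ℂ} (h : α * conj α + β * conj β = 1) :
    ∃ ω θ φ : ℝ, Rz ω * Ry θ * Rz φ = !![α, -conj β; β, conj α] := by
  have hn : ‖α‖ ^ 2 + ‖β‖ ^ 2 = 1 := by
    rw [Complex.mul_conj', Complex.mul_conj'] at h
    exact_mod_cast h
  have hle : ‖α‖ ≤ 1 := by nlinarith [norm_nonneg α, sq_nonneg ‖β‖]
  have hcos : Real.cos (Real.arccos ‖α‖) = ‖α‖ :=
    Real.cos_arccos (by linarith [norm_nonneg α]) hle
  have hsin : Real.sin (Real.arccos ‖α‖) = ‖β‖ := by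
    rw [Real.sin_arccos, show 1 - ‖α‖ ^ 2 = ‖β‖ ^ 2 by linarith, Real.sqrt_sq (norm_nonneg β)]
  have hα : (‖α‖ : ℂ) * Complex.exp (α.arg * Complex.I) = α := Complex.norm_mul_exp_arg_mul_I α
  have hβ : (‖β‖ : ℂ) * Complex.exp (β.arg * Complex.I) = β := Complex.norm_mul_exp_arg_mul_I β
  have hα' : conj α = ‖α‖ * Complex.exp (-(α.arg * Complex.I)) := by
    conv_lhs => rw [← hα]
    rw [map_mul, Complex.conj_ofReal, ← Complex.exp_conj, map_mul, Complex.conj_ofReal,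
      Complex.conj_I, mul_neg]
  have hβ' : conj β = ‖β‖ * Complex.exp (-(β.arg * Complex.I)) := by
    conv_lhs => rw [← hβ]
    rw [map_mul, Complex.conj_ofReal, ← Complex.exp_conj, map_mul, Complex.conj_ofReal,
      Complex.conj_I, mul_neg]
  refine ⟨β.arg - α.arg, 2 * Real.arccos ‖α‖, -α.arg - β.arg, ?_⟩
  have key (r a b c : ℂ) (habc : a + b = c) :
      Complex.exp a * r * Complex.exp b = r * Complex.exp c := by
    rw [← habc, Complex.exp_add]
    ring
  have h00 := (key ‖α‖ (-(Complex.I * ↑(β.arg - α.arg) / 2))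
    (-(Complex.I * ↑(-α.arg - β.arg) / 2)) _ (by push_cast; ring)).trans hα
  have h01 := (key ‖β‖ (-(Complex.I * ↑(β.arg - α.arg) / 2))
    (Complex.I * ↑(-α.arg - β.arg) / 2) _ (by push_cast; ring)).trans hβ'.symm
  have h10 := (key ‖β‖ (Complex.I * ↑(β.arg - α.arg) / 2)
    (-(Complex.I * ↑(-α.arg - β.arg) / 2)) _ (by push_cast; ring)).trans hβ
  have h11 := (key ‖α‖ (Complex.I * ↑(β.arg - α.arg) / 2)
    (Complex.I * ↑(-α.arg - β.arg) / 2) _ (by push_cast; ring)).trans hα'.symm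
  simp only [Rz, Ry, mul_div_cancel_left₀ _ (two_ne_zero' ℝ), hcos, hsin, Matrix.mul_fin_two,
    mul_zero, zero_mul, add_zero, zero_add, mul_neg, neg_mul, neg_zero,
    h00, h01, h10, h11]

theorem exists_Wqsp_succ_eq (L : ℕ) (ω ω' θ₀ φ₀ : ℝ) (θ φ : ℕ → ℝ) :
    ∃ θ' φ' : ℕ → ℝ, ∀ x : ℝ, Wqsp (L + 1) ω θ' φ' x =
      Rz ω * Ry θ₀ * Rz φ₀ * Rz x * Wqsp L ω' θ φ x := by
  refine ⟨fun n => Nat.casesOn n θ₀ θ, fun n => Nat.casesOn n (φ₀ + ω') φ, fun x => ?_⟩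
  have hc : Rz (φ₀ + ω') * Rz x = Rz φ₀ * Rz x * Rz ω' := by
    rw [Rz_mul_Rz, Rz_mul_Rz, Rz_mul_Rz, add_right_comm]
  simp only [Wqsp, List.range_succ_eq_map, List.map_cons, List.prod_cons, List.map_map,
    Function.comp_def, Nat.succ_eq_add_one]
  calc _ = Rz ω * Ry θ₀ * (Rz (φ₀ + ω') * Rz x) * Ry (θ 0) * Rz (φ 0) *
        ((List.range L).map (fun l => Rz x * Ry (θ (l + 1)) * Rz (φ (l + 1)))).prod := by
          simp only [mul_assoc]
          rfl
    _ = _ := by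
      rw [hc]
      simp only [mul_assoc]

/-- Orthogonality of the extreme coefficients of a normalised pair of polynomials. -/
theorem extreme_coeff_orthogonal {L : ℕ} {p q : ℂ[X]} (hp : p.natDegree ≤ L + 1)
    (hq : q.natDegree ≤ L + 1)
    (h : ∀ z : ℂ, ‖z‖ = 1 → p.eval z * conj (p.eval z) + q.eval z * conj (q.eval z) = 1) :
    p.coeff 0 * conj (p.coeff (L + 1)) + q.coeff 0 * conj (q.coeff (L + 1)) = 0 := by
  have hpoly : p * reflect (L + 1) (p.map (starRingEnd ℂ)) +
      q * reflect (L + 1) (q.map (starRingEnd ℂ)) = X ^ (L + 1) := by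
    refine eq_of_eval_eq_on_unit_circle fun z hz => ?_
    have hz0 : z ≠ 0 := by rintro rfl; simp at hz
    rw [eval_add, eval_mul, eval_mul, eval_reflect_map_conj hp hz0, eval_reflect_map_conj hq hz0,
      inv_conj_of_norm_eq_one hz, eval_pow, eval_X]
    linear_combination z ^ (L + 1) * h z hz
  simpa [mul_coeff_zero, coeff_reflect, revAt_le] using congrArg (fun r => coeff r 0) hpoly

theorem exists_unit_pair_mul_eq {a b : ℂ} (hab : a ≠ 0 ∨ b ≠ 0) :
    ∃ α β : ℂ, α * conj α + β * conj β = 1 ∧ ∃ r : ℂ, a = r * α ∧ b = r * β := by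
  set s := Real.sqrt (Complex.normSq a + Complex.normSq b)
  have hpos : 0 < Complex.normSq a + Complex.normSq b := by
    rcases hab with h | h
    · have := Complex.normSq_pos.2 h; have := Complex.normSq_nonneg b; positivity
    · have := Complex.normSq_pos.2 h; have := Complex.normSq_nonneg a; positivity
  have hs : (s : ℂ) ≠ 0 := by exact_mod_cast (Real.sqrt_pos.2 hpos).ne'
  have hs2 : (s : ℂ) * s = a * conj a + b * conj b := by
    rw [Complex.mul_conj, Complex.mul_conj]
    exact_mod_cast Real.mul_self_sqrt hpos.le
  refine ⟨a / s, b / s, ?_, s, by field_simp, by field_simp⟩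
  simp only [map_div₀, Complex.conj_ofReal]
  field_simp
  rw [pow_two, hs2]

/-- Orthogonal vectors in `ℂ²` are simultaneously adapted to some `SU(2)` frame. -/
theorem exists_adapted_frame {a b c d : ℂ} (h : a * conj c + b * conj d = 0) :
    ∃ α β : ℂ, α * conj α + β * conj β = 1 ∧ -β * a + α * b = 0 ∧
      conj α * c + conj β * d = 0 := by
  have h' : conj a * c + conj b * d = 0 := by simpa using congrArg (starRingEnd ℂ) h
  by_cases hab : a ≠ 0 ∨ b ≠ 0
  · obtain ⟨α, β, h1, r, rfl, rfl⟩ := exists_unit_pair_mul_eq hab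
    have hr : conj r ≠ 0 := by
      rw [Ne, map_eq_zero]
      rintro rfl
      simp at hab
    refine ⟨α, β, h1, by ring, mul_left_cancel₀ hr ?_⟩
    simp only [map_mul] at h'
    linear_combination h'
  · push Not at hab
    obtain ⟨rfl, rfl⟩ := hab
    by_cases hcd : d ≠ 0 ∨ c ≠ 0
    · obtain ⟨α, β, h1, r, rfl, rfl⟩ := exists_unit_pair_mul_eq hcd
      refine ⟨conj α, -conj β, ?_, by ring, ?_⟩
      · simp only [map_neg, Complex.conj_conj]
        linear_combination h1
      · simp only [map_neg, Complex.conj_conj]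
        ring
    · push Not at hcd
      obtain ⟨rfl, rfl⟩ := hcd
      exact ⟨1, 0, by simp, by simp, by simp⟩

/-- **Trigonometric QSP**: every normalised pair of polynomials of degree at most `L` is, up to
the factor `e^{-iLx/2}`, the first column of a QSP unitary. -/
theorem exists_qsp_angles (L : ℕ) : ∀ p q : ℂ[X], p.natDegree ≤ L → q.natDegree ≤ L →
    (∀ z : ℂ, ‖z‖ = 1 → p.eval z * conj (p.eval z) + q.eval z * conj (q.eval z) = 1) →
    ∃ (ω : ℝ) (θ φ : ℕ → ℝ), ∀ x : ℝ,
      Wqsp L ω θ φ x 0 0 =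
        Complex.exp (-(L * (Complex.I * x / 2))) * p.eval (Complex.exp (Complex.I * x)) ∧
      Wqsp L ω θ φ x 1 0 =
        Complex.exp (-(L * (Complex.I * x / 2))) * q.eval (Complex.exp (Complex.I * x)) := by
  induction L with
  | zero =>
    intro p q hp hq h
    obtain ⟨a, rfl⟩ := natDegree_eq_zero.1 (by simpa using hp)
    obtain ⟨b, rfl⟩ := natDegree_eq_zero.1 (by simpa using hq)
    obtain ⟨ω, θ, φ, hW⟩ := exists_euler_angles (by simpa using h 1 (by simp))
    exact ⟨ω, fun _ => θ, fun _ => φ, fun x => by simp [Wqsp, hW]⟩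
  | succ L ih =>
    intro p q hp hq h
    obtain ⟨α, β, hαβ, hlow, hhigh⟩ :=
      exists_adapted_frame (extreme_coeff_orthogonal hp hq h)
    set p' := C (conj α) * p + C (conj β) * q with hp'
    obtain ⟨q', hq'⟩ : X ∣ C (-β) * p + C α * q :=
      X_dvd_iff.2 (by simpa [mul_coeff_zero] using hlow)
    have hp'deg : p'.natDegree ≤ L := by
      rw [natDegree_le_iff_coeff_eq_zero]
      intro n hn
      rcases eq_or_lt_of_le (Nat.succ_le_of_lt hn) with h1 | h1
      · rw [← h1]; simpa [hp'] using hhigh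
      · simp [hp', coeff_eq_zero_of_natDegree_lt (hp.trans_lt h1),
          coeff_eq_zero_of_natDegree_lt (hq.trans_lt h1)]
    have hq'deg : q'.natDegree ≤ L := by
      rw [natDegree_le_iff_coeff_eq_zero]
      intro n hn
      rw [← coeff_X_mul, ← hq']
      simp [coeff_eq_zero_of_natDegree_lt (show p.natDegree < n + 1 by omega),
        coeff_eq_zero_of_natDegree_lt (show q.natDegree < n + 1 by omega)]
    have hpe (z : ℂ) : p'.eval z = conj α * p.eval z + conj β * q.eval z := by simp [hp']
    have hqe (z : ℂ) : z * q'.eval z = -β * p.eval z + α * q.eval z := by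
      simpa using congrArg (eval z) hq'.symm
    obtain ⟨ω', θ, φ, hW⟩ := ih p' q' hp'deg hq'deg fun z hz => by
      have hzz := conj_mul_self_of_norm_eq_one hz
      have h1 : q'.eval z * conj (q'.eval z) =
          (z * q'.eval z) * conj (z * q'.eval z) := by
        rw [map_mul]
        linear_combination (-(q'.eval z * conj (q'.eval z))) * hzz
      rw [h1, hqe, hpe]
      simp only [map_add, map_mul, map_neg, Complex.conj_conj]
      linear_combination h z hz + (p.eval z * conj (p.eval z) + q.eval z * conj (q.eval z)) * hαβ
    obtain ⟨ω, θ₀, φ₀, hA⟩ := exists_euler_angles hαβ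
    obtain ⟨θ', φ', hsucc⟩ := exists_Wqsp_succ_eq L ω ω' θ₀ φ₀ θ φ
    refine ⟨ω, θ', φ', fun x => ?_⟩
    rw [hsucc, hA]
    set z := Complex.exp (Complex.I * x) with hz
    set v := Complex.exp (-(L * (Complex.I * x / 2))) with hv
    set w := Complex.exp (-(Complex.I * x / 2)) with hw
    have hexp : Complex.exp (-(((L + 1 : ℕ) : ℂ) * (Complex.I * x / 2))) = v * w := by
      rw [hv, hw, ← Complex.exp_add]
      push_cast
      ring_nf
    have hwz : Complex.exp (Complex.I * x / 2) = w * z := by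
      rw [hw, hz, ← Complex.exp_add]
      ring_nf
    have h1 := (hW x).1
    have h2 := (hW x).2
    have hR : Rz x = !![w, 0; 0, w * z] := by rw [Rz, hwz]
    rw [hR, hexp]
    constructor
    · simp only [Matrix.mul_apply, Fin.sum_univ_two, h1, h2, Matrix.of_apply, Matrix.cons_val',
        Matrix.cons_val_zero, Matrix.cons_val_one, Matrix.cons_val_fin_one]
      linear_combination (α * v * w) * hpe z - conj β * v * w * hqe z +
        v * w * p.eval z * hαβ
    · simp only [Matrix.mul_apply, Fin.sum_univ_two, h1, h2, Matrix.of_apply, Matrix.cons_val',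
        Matrix.cons_val_zero, Matrix.cons_val_one, Matrix.cons_val_fin_one]
      linear_combination (β * v * w) * hpe z + conj α * v * w * hqe z +
        v * w * q.eval z * hαβ

/-- A bounded real trigonometric polynomial is `|p|² - |q|²` for a normalised pair `p, q`. -/
theorem exists_polynomial_pair {L : ℕ} {c : ℤ → ℂ} {F : ℝ → ℂ}
    (hF : ∀ x : ℝ, F x =
      ∑ j ∈ Finset.Icc (-(L : ℤ)) (L : ℤ), c j * Complex.exp (Complex.I * j * x))
    (hreal : ∀ x : ℝ, (F x).im = 0) (hbound : ∀ x : ℝ, ‖F x‖ ≤ 1) :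
    ∃ p q : ℂ[X], p.natDegree ≤ L ∧ q.natDegree ≤ L ∧
      (∀ z : ℂ, ‖z‖ = 1 →
        p.eval z * conj (p.eval z) + q.eval z * conj (q.eval z) = 1) ∧
      ∀ x : ℝ, p.eval (Complex.exp (Complex.I * x)) *
          conj (p.eval (Complex.exp (Complex.I * x))) -
        q.eval (Complex.exp (Complex.I * x)) *
          conj (q.eval (Complex.exp (Complex.I * x))) = F x := by
  set f : ℂ[X] := ∑ n ∈ Finset.range (2 * L + 1), C (c (n - L)) * X ^ n with hf
  have hfd : f.natDegree ≤ 2 * L := natDegree_sum_le_of_forall_le _ _ fun n hn =>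
    (natDegree_C_mul_X_pow_le _ _).trans (by have := Finset.mem_range.1 hn; omega)
  have hfe (x : ℝ) : f.eval (Complex.exp (Complex.I * x)) *
      conj (Complex.exp (Complex.I * x)) ^ L = F x := by
    rw [hF, hf, eval_finsetSum, Finset.sum_mul]
    refine Finset.sum_bij' (fun n _ => (n : ℤ) - L) (fun j _ => (j + L).toNat) ?_ ?_ ?_ ?_ ?_
    · intro n hn
      have := Finset.mem_range.1 hn
      rw [Finset.mem_Icc]; omega
    · intro j hj
      rw [Finset.mem_Icc] at hj
      rw [Finset.mem_range]; omega
    · intro n _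
      simp
    · intro j hj
      rw [Finset.mem_Icc] at hj
      omega
    · intro n _
      rw [eval_C_mul, eval_pow, eval_X, mul_assoc, ← Complex.exp_conj, ← Complex.exp_nat_mul,
        ← Complex.exp_nat_mul, ← Complex.exp_add]
      congr 2
      simp only [map_mul, Complex.conj_I, Complex.conj_ofReal]
      push_cast
      ring
  have hcircle {z : ℂ} (hz : ‖z‖ = 1) : ∃ x : ℝ, Complex.exp (Complex.I * x) = z := by
    refine ⟨z.arg, ?_⟩
    simpa [hz, mul_comm Complex.I] using Complex.norm_mul_exp_arg_mul_I z
  have hsigned (ε : ℝ) (hε : |ε| = 1) : ∃ p : ℂ[X], p.natDegree ≤ L ∧ ∀ x : ℝ,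
      p.eval (Complex.exp (Complex.I * x)) *
        conj (p.eval (Complex.exp (Complex.I * x))) = (1 + ε * F x) / 2 := by
    set g : ℂ[X] := C (1 / 2) * (X ^ L + C (ε : ℂ) * f) with hg
    have hgd : g.natDegree ≤ 2 * L :=
      (natDegree_C_mul_le _ _).trans (natDegree_add_le_of_degree_le
        ((natDegree_X_pow_le _).trans (by omega)) ((natDegree_C_mul_le _ _).trans hfd))
    have hge (x : ℝ) : g.eval (Complex.exp (Complex.I * x)) *
        conj (Complex.exp (Complex.I * x)) ^ L = (1 + ε * F x) / 2 := by
      have h1 : (Complex.exp (Complex.I * x) * conj (Complex.exp (Complex.I * x))) ^ L = 1 := by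
        rw [mul_comm, conj_mul_self_of_norm_eq_one, one_pow]
        rw [mul_comm]
        exact Complex.norm_exp_ofReal_mul_I x
      rw [mul_pow] at h1
      simp only [hg, eval_mul, eval_add, eval_pow, eval_X, eval_C]
      linear_combination (1 / 2) * h1 + ε / 2 * hfe x
    obtain ⟨p, hp, hpe⟩ := fejer_riesz L g hgd fun z hz => by
      obtain ⟨x, rfl⟩ := hcircle hz
      have hFx : F x = ((F x).re : ℂ) := Complex.ext (by simp) (by simp [hreal])
      have hb : |ε * (F x).re| ≤ 1 := by
        rw [abs_mul, hε, one_mul]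
        exact (Complex.abs_re_le_norm _).trans (hbound x)
      have hnn : 0 ≤ (1 + ε * (F x).re) / 2 := by linarith [(abs_le.1 hb).1]
      rw [hge, hFx]
      exact_mod_cast hnn
    refine ⟨p, hp, fun x => ?_⟩
    rw [← hge, hpe]
    rw [mul_comm]
    exact Complex.norm_exp_ofReal_mul_I x
  obtain ⟨p, hp, hpe⟩ := hsigned 1 (by simp)
  obtain ⟨q, hq, hqe⟩ := hsigned (-1) (by simp)
  refine ⟨p, q, hp, hq, fun z hz => ?_, fun x => ?_⟩
  · obtain ⟨x, rfl⟩ := hcircle hz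
    rw [hpe, hqe]
    push_cast
    ring
  · rw [hpe, hqe]
    push_cast
    ring

section Spectral

variable {n : Type*} [Fintype n]

/-- `∑ⱼ M j ⊗ χⱼ χⱼ†`: the operator acting as `M j` on the ancilla when the register is in
state `χⱼ`. -/
noncomputable def spectralLift (χ : n → n → ℂ) (M : n → Matrix (Fin 2) (Fin 2) ℂ) :
    Matrix (Fin 2 × n) (Fin 2 × n) ℂ :=
  ∑ j, M j ⊗ₖ Matrix.vecMulVec (χ j) (star (χ j))

variable {χ : n → n → ℂ}

theorem conjTranspose_spectralLift (M : n → Matrix (Fin 2) (Fin 2) ℂ) :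
    (spectralLift χ M)ᴴ = spectralLift χ (fun j => (M j)ᴴ) := by
  simp [spectralLift, Matrix.conjTranspose_sum, Matrix.conjTranspose_kronecker,
    Matrix.conjTranspose_vecMulVec]

theorem spectralLift_add (M M' : n → Matrix (Fin 2) (Fin 2) ℂ) :
    spectralLift χ M + spectralLift χ M' = spectralLift χ (fun j => M j + M' j) := by
  simp [spectralLift, Matrix.add_kronecker, Finset.sum_add_distrib]

theorem kronecker_sum_smul (A : Matrix (Fin 2) (Fin 2) ℂ) (d : n → ℂ) :
    A ⊗ₖ (∑ j, d j • Matrix.vecMulVec (χ j) (star (χ j))) =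
      spectralLift χ (fun j => d j • A) := by
  ext ⟨a, i⟩ ⟨b, k⟩
  simp only [spectralLift, Matrix.kronecker_apply, Matrix.sum_apply, Matrix.smul_apply,
    smul_eq_mul, Finset.mul_sum]
  exact Finset.sum_congr rfl fun j _ => by ring

variable [DecidableEq n]

theorem sum_vecMulVec_star_eq_one
    (horth : ∀ j k, ∑ i, (starRingEnd ℂ) (χ j i) * χ k i = if j = k then 1 else 0) :
    ∑ j, Matrix.vecMulVec (χ j) (star (χ j)) = 1 := by
  have h : (Matrix.of χ).map (starRingEnd ℂ) * (Matrix.of χ)ᵀ = 1 := by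
    ext j k
    simpa [Matrix.mul_apply, Matrix.one_apply] using horth j k
  have h' := mul_eq_one_comm.1 h
  rw [← h']
  ext i k
  simp [Matrix.sum_apply, Matrix.mul_apply, Matrix.vecMulVec_apply]

theorem star_dotProduct_eq
    (horth : ∀ j k, ∑ i, (starRingEnd ℂ) (χ j i) * χ k i = if j = k then 1 else 0) (j k : n) :
    star (χ j) ⬝ᵥ χ k = if j = k then 1 else 0 := by
  simpa [dotProduct] using horth j k

theorem spectralLift_mul
    (horth : ∀ j k, ∑ i, (starRingEnd ℂ) (χ j i) * χ k i = if j = k then 1 else 0)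
    (M M' : n → Matrix (Fin 2) (Fin 2) ℂ) :
    spectralLift χ M * spectralLift χ M' = spectralLift χ (fun j => M j * M' j) := by
  simp only [spectralLift, Finset.sum_mul, Finset.mul_sum, ← Matrix.mul_kronecker_mul,
    Matrix.vecMulVec_mul_vecMulVec, star_dotProduct_eq horth]
  refine Finset.sum_congr rfl fun j _ => ?_
  rw [Finset.sum_eq_single j (fun k _ hk => by simp [hk]) (by simp)]
  simp

theorem kronecker_one_eq
    (horth : ∀ j k, ∑ i, (starRingEnd ℂ) (χ j i) * χ k i = if j = k then 1 else 0)
    (A : Matrix (Fin 2) (Fin 2) ℂ) :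
    A ⊗ₖ (1 : Matrix n n ℂ) = spectralLift χ (fun _ => A) := by
  simpa [sum_vecMulVec_star_eq_one horth] using kronecker_sum_smul (χ := χ) A (fun _ => 1)

theorem eq_sum_of_eigenbasis
    (horth : ∀ j k, ∑ i, (starRingEnd ℂ) (χ j i) * χ k i = if j = k then 1 else 0)
    {U : Matrix n n ℂ} {d : n → ℂ} (heig : ∀ j, U.mulVec (χ j) = d j • χ j) :
    U = ∑ j, d j • Matrix.vecMulVec (χ j) (star (χ j)) := by
  rw [← mul_one U, ← sum_vecMulVec_star_eq_one horth, Finset.mul_sum]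
  simp [Matrix.mul_vecMulVec, heig, Matrix.smul_vecMulVec]

variable {τ : n → ℝ} {U : Matrix n n ℂ}

theorem blockDiag2_one_eq
    (horth : ∀ j k, ∑ i, (starRingEnd ℂ) (χ j i) * χ k i = if j = k then 1 else 0)
    (heig : ∀ j, U.mulVec (χ j) = Complex.exp (Complex.I * τ j) • χ j) :
    blockDiag2 1 U =
      spectralLift χ (fun j => Complex.exp (Complex.I * τ j / 2) • Rz (τ j)) := by
  rw [blockDiag2, kronecker_one_eq horth, eq_sum_of_eigenbasis horth heig, kronecker_sum_smul,
    spectralLift_add]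
  congr 1
  funext j
  ext a b
  fin_cases a <;> fin_cases b <;> simp [Rz, ← Complex.exp_add]

theorem blockDiag2_conjTranspose_eq
    (horth : ∀ j k, ∑ i, (starRingEnd ℂ) (χ j i) * χ k i = if j = k then 1 else 0)
    (heig : ∀ j, U.mulVec (χ j) = Complex.exp (Complex.I * τ j) • χ j) :
    blockDiag2 Uᴴ 1 =
      spectralLift χ (fun j => Complex.exp (-(Complex.I * τ j / 2)) • Rz (τ j)) := by
  have hU : Uᴴ = ∑ j, Complex.exp (-(Complex.I * τ j)) •
      Matrix.vecMulVec (χ j) (star (χ j)) := by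
    rw [eq_sum_of_eigenbasis horth heig]
    simp [Matrix.conjTranspose_sum, Matrix.conjTranspose_smul, Matrix.conjTranspose_vecMulVec,
      ← Complex.exp_conj]
  rw [blockDiag2, kronecker_one_eq horth, hU, kronecker_sum_smul, spectralLift_add]
  congr 1
  funext j
  ext a b
  fin_cases a <;> fin_cases b <;> simp [Rz, ← Complex.exp_add]
  ring_nf

theorem Wqsp_succ (L : ℕ) (ω : ℝ) (θ φ : ℕ → ℝ) (x : ℝ) :
    Wqsp (L + 1) ω θ φ x = Wqsp L ω θ φ x * Rz x * (Ry (θ (L + 1)) * Rz (φ (L + 1))) := by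
  simp [Wqsp, List.range_succ, mul_assoc]

theorem qppEven_eq_spectralLift
    (horth : ∀ j k, ∑ i, (starRingEnd ℂ) (χ j i) * χ k i = if j = k then 1 else 0)
    (heig : ∀ j, U.mulVec (χ j) = Complex.exp (Complex.I * τ j) • χ j)
    (m : ℕ) (ω : ℝ) (θ φ : ℕ → ℝ) :
    qppEven U m ω θ φ = spectralLift χ (fun j => Wqsp (2 * m) ω θ φ (τ j)) := by
  induction m with
  | zero => simp [qppEven, Wqsp, kronecker_one_eq horth]
  | succ m ih =>
    have hstep : qppEven U (m + 1) ω θ φ = qppEven U m ω θ φ * (blockDiag2 Uᴴ 1 *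
        ((Ry (θ (2 * m + 1)) * Rz (φ (2 * m + 1))) ⊗ₖ (1 : Matrix n n ℂ)) *
        blockDiag2 1 U *
        ((Ry (θ (2 * m + 2)) * Rz (φ (2 * m + 2))) ⊗ₖ (1 : Matrix n n ℂ))) := by
      simp [qppEven, List.range_succ, mul_assoc]
    rw [hstep, ih, blockDiag2_conjTranspose_eq horth heig, blockDiag2_one_eq horth heig]
    simp only [kronecker_one_eq horth, spectralLift_mul horth]
    congr 1
    funext j
    rw [show 2 * (m + 1) = 2 * m + 1 + 1 by ring, Wqsp_succ, Wqsp_succ]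
    simp only [smul_mul_assoc, mul_smul_comm, smul_smul, ← Complex.exp_add, mul_assoc]
    simp

theorem qpp_eq_spectralLift
    (horth : ∀ j k, ∑ i, (starRingEnd ℂ) (χ j i) * χ k i = if j = k then 1 else 0)
    (heig : ∀ j, U.mulVec (χ j) = Complex.exp (Complex.I * τ j) • χ j)
    (L : ℕ) (ω : ℝ) (θ φ : ℕ → ℝ) :
    ∃ s : n → ℂ, (∀ j, ‖s j‖ = 1) ∧
      qpp U L ω θ φ = spectralLift χ (fun j => s j • Wqsp L ω θ φ (τ j)) := by
  rcases Nat.even_or_odd' L with ⟨m, rfl | rfl⟩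
  · refine ⟨fun _ => 1, by simp, ?_⟩
    simp [qpp, qppEven_eq_spectralLift horth heig]
  · refine ⟨fun j => Complex.exp (-(Complex.I * τ j / 2)), fun j => ?_, ?_⟩
    · simp [Complex.norm_exp]
    · rw [qpp, if_neg (by omega), show (2 * m + 1) / 2 = m by omega,
        qppEven_eq_spectralLift horth heig, blockDiag2_conjTranspose_eq horth heig]
      simp only [kronecker_one_eq horth, spectralLift_mul horth]
      simp only [Wqsp_succ, smul_mul_assoc, mul_smul_comm]

theorem trace_mul_spectralLift
    (horth : ∀ j k, ∑ i, (starRingEnd ℂ) (χ j i) * χ k i = if j = k then 1 else 0)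
    (M : n → Matrix (Fin 2) (Fin 2) ℂ) (ρ : Matrix n n ℂ) :
    Matrix.trace
        (((!![1, 0; 0, -1] : Matrix (Fin 2) (Fin 2) ℂ) ⊗ₖ (1 : Matrix n n ℂ)) *
          (spectralLift χ M * ((!![1, 0; 0, 0] : Matrix (Fin 2) (Fin 2) ℂ) ⊗ₖ ρ) *
            (spectralLift χ M)ᴴ)) =
      ∑ j, (M j 0 0 * conj (M j 0 0) - M j 1 0 * conj (M j 1 0)) *
        (star (χ j) ⬝ᵥ ρ.mulVec (χ j)) := by
  rw [← mul_assoc, Matrix.trace_mul_comm, kronecker_one_eq horth, conjTranspose_spectralLift,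
    ← mul_assoc, ← mul_assoc, spectralLift_mul horth, spectralLift_mul horth]
  simp only [spectralLift, Finset.sum_mul, Matrix.trace_sum, ← Matrix.mul_kronecker_mul,
    Matrix.trace_kronecker]
  refine Finset.sum_congr rfl fun j _ => ?_
  congr 1
  · simp [Matrix.trace, Matrix.mul_apply, Fin.sum_univ_two]
    ring
  · rw [Matrix.trace_mul_comm, Matrix.mul_vecMulVec, Matrix.trace_vecMulVec, dotProduct_comm]

end Spectral

/-- quantum phase evaluation. There are QPP parameters such that the expectation
of `Z ⊗ I` on the evolved state `V (|0⟩⟨0| ⊗ ρ) V†` equals `Σ_j ⟨χ_j, ρ χ_j⟩ F(τ_j)`. -/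
theorem stmt_7 (N : ℕ) (U : Matrix (Fin N) (Fin N) ℂ)
    (hU : U ∈ Matrix.unitaryGroup (Fin N) ℂ)
    (χ : Fin N → Fin N → ℂ) (τ : Fin N → ℝ)
    (horth : ∀ j k : Fin N,
      ∑ i, (starRingEnd ℂ) (χ j i) * χ k i = if j = k then 1 else 0)
    (heig : ∀ j : Fin N, U.mulVec (χ j) = Complex.exp (Complex.I * τ j) • χ j)
    (ρ : Matrix (Fin N) (Fin N) ℂ) (hρ : ρ.PosSemidef) (htrρ : ρ.trace = 1)
    (L : ℕ) (c : ℤ → ℂ) (F : ℝ → ℂ)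
    (hF : ∀ x : ℝ, F x =
      ∑ j ∈ Finset.Icc (-(L : ℤ)) (L : ℤ), c j * Complex.exp (Complex.I * j * x))
    (hreal : ∀ x : ℝ, (F x).im = 0)
    (hbound : ∀ x : ℝ, ‖F x‖ ≤ 1) :
    ∃ (ω : ℝ) (θ φ : ℕ → ℝ),
      Matrix.trace
        (((!![1, 0; 0, -1] : Matrix (Fin 2) (Fin 2) ℂ) ⊗ₖ (1 : Matrix (Fin N) (Fin N) ℂ)) *
          (qpp U L ω θ φ *
            ((!![1, 0; 0, 0] : Matrix (Fin 2) (Fin 2) ℂ) ⊗ₖ ρ) *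
            (qpp U L ω θ φ)ᴴ)) =
      ∑ j, (star (χ j) ⬝ᵥ ρ.mulVec (χ j)) * F (τ j) := by
  obtain ⟨p, q, hp, hq, hsum, hdiff⟩ := exists_polynomial_pair hF hreal hbound
  obtain ⟨ω, θ, φ, hW⟩ := exists_qsp_angles L p q hp hq hsum
  refine ⟨ω, θ, φ, ?_⟩
  obtain ⟨s, hs, hV⟩ := qpp_eq_spectralLift horth heig L ω θ φ
  rw [hV, trace_mul_spectralLift horth]
  refine Finset.sum_congr rfl fun j _ => ?_
  rw [mul_comm]
  congr 1
  have hsj : conj (s j) * s j = 1 := conj_mul_self_of_norm_eq_one (hs j)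
  have hv : conj (Complex.exp (-(L * (Complex.I * τ j / 2)))) *
      Complex.exp (-(L * (Complex.I * τ j / 2))) = 1 :=
    conj_mul_self_of_norm_eq_one (by simp [Complex.norm_exp])
  set v := Complex.exp (-(L * (Complex.I * τ j / 2)))
  rw [← hdiff]
  simp only [Matrix.smul_apply, smul_eq_mul, (hW (τ j)).1, (hW (τ j)).2, map_mul]
  linear_combination (p.eval (Complex.exp (Complex.I * τ j)) *
      conj (p.eval (Complex.exp (Complex.I * τ j))) -
      q.eval (Complex.exp (Complex.I * τ j)) * conj (q.eval (Complex.exp (Complex.I * τ j)))) *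
    (conj v * v * hsj + hv)
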